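/- Define L(x) = ∫_{|h|<1} |i₁(x+h) − i₁(x) + (n−1) c_n (h·x)/|x|^{n+1} χ_{|x|>2}(x)| dh, where i₁(x) = c_n|x|^{1−n} is the Riesz potential kernel (n ≥ 2). Then |L(x)| ≤ C(n) min(|x|^{1−n}, |x|^{−n−1}) for all x ≠ 0; in particular L is dominated by a radial decreasing integrable function. -/

import Mathlib

open MeasureTheory RealInnerProductSpace

/-- For a nonpositive exponent, `u ↦ u ^ p` is Lipschitz at `1` on `[1/4, ∞)`. -/
lemma exists_abs_rpow_sub_one_le {p : ℝ} (hp : p ≤ 0) :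
    ∃ K : ℝ, 0 ≤ K ∧ ∀ u : ℝ, 1 / 4 ≤ u → |u ^ p - 1| ≤ K * |u - 1| := by
  refine ⟨|p| * (1 / 4 : ℝ) ^ (p - 1), by positivity, fun u hu ↦ ?_⟩
  have h := (convex_Ici (1 / 4 : ℝ)).norm_image_sub_le_of_norm_hasDerivWithin_le
    (f := fun v : ℝ ↦ v ^ p) (f' := fun v ↦ p * v ^ (p - 1))
    (C := |p| * (1 / 4 : ℝ) ^ (p - 1)) (x := 1) (y := u)
    (fun v hv ↦ (Real.hasDerivAt_rpow_const
      (Or.inl (by simp only [Set.mem_Ici] at hv; linarith))).hasDerivWithinAt)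
    (fun v hv ↦ by
      simp only [Set.mem_Ici] at hv
      have hv0 : 0 < v := by linarith
      rw [norm_mul, Real.norm_eq_abs, Real.norm_of_nonneg (by positivity : 0 ≤ v ^ (p - 1))]
      gcongr ?_ * ?_
      exact Real.rpow_le_rpow_of_nonpos (by norm_num) hv (by linarith))
    (by norm_num) hu
  simpa using h

/-- Second order Taylor estimate at `1` for `u ↦ u ^ p` on `[1/4, ∞)`, `p ≤ 0`. -/
lemma exists_abs_rpow_sub_one_sub_mul_le {p : ℝ} (hp : p ≤ 0) :
    ∃ K : ℝ, 0 ≤ K ∧ ∀ u : ℝ, 1 / 4 ≤ u →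
      |u ^ p - 1 - p * (u - 1)| ≤ K * (u - 1) ^ 2 := by
  obtain ⟨K, hK0, hK⟩ := exists_abs_rpow_sub_one_le (p := p - 1) (by linarith)
  refine ⟨|p| * K, by positivity, fun u hu ↦ ?_⟩
  have hge : ∀ v ∈ Set.uIcc 1 u, 1 / 4 ≤ v := fun v hv ↦
    (le_min (by norm_num) hu).trans hv.1
  have h := (convex_uIcc 1 u).norm_image_sub_le_of_norm_hasDerivWithin_le
    (f := fun v : ℝ ↦ v ^ p - p * v) (f' := fun v ↦ p * v ^ (p - 1) - p * 1)
    (C := |p| * (K * |u - 1|)) (x := 1) (y := u)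
    (fun v hv ↦ ((Real.hasDerivAt_rpow_const
      (Or.inl (by linarith [hge v hv]))).sub ((hasDerivAt_id v).const_mul p)).hasDerivWithinAt)
    (fun v hv ↦ by
      rw [← mul_sub, norm_mul, Real.norm_eq_abs, Real.norm_eq_abs]
      have := Set.abs_sub_left_of_mem_uIcc hv
      refine mul_le_mul_of_nonneg_left ((hK v (hge v hv)).trans ?_) (abs_nonneg p)
      gcongr)
    Set.left_mem_uIcc Set.right_mem_uIcc
  simp only [Real.one_rpow, Real.norm_eq_abs] at h
  calc |u ^ p - 1 - p * (u - 1)| = |u ^ p - p * u - (1 - p * 1)| := by ring_nf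
    _ ≤ |p| * (K * |u - 1|) * |u - 1| := h
    _ = |p| * K * (u - 1) ^ 2 := by rw [← sq_abs (u - 1)]; ring

/-- `‖y‖ ^ (1 - n)` is integrable on balls around the origin of `ℝⁿ`. -/
lemma integrableOn_ball_norm_rpow_one_sub (n : ℕ) (hn : 2 ≤ n) (R : ℝ) :
    IntegrableOn (fun y : EuclideanSpace ℝ (Fin n) ↦ ‖y‖ ^ ((1 : ℝ) - n))
      (Metric.ball 0 R) := by
  have : Nontrivial (EuclideanSpace ℝ (Fin n)) :=
    Module.nontrivial_of_finrank_pos (R := ℝ) (by simp; omega)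
  refine (integrableOn_fun_norm_addHaar (volume : Measure (EuclideanSpace ℝ (Fin n)))
    (f := fun t : ℝ ↦ t ^ ((1 : ℝ) - n))).2 ?_
  have h1 : IntegrableOn (fun _ ↦ (1 : ℝ)) (Set.Ioo 0 R) :=
    integrableOn_const measure_Ioo_lt_top.ne
  refine h1.congr_fun (fun t ht ↦ ?_) measurableSet_Ioo
  rw [finrank_euclideanSpace_fin, smul_eq_mul, ← Real.rpow_natCast, ← Real.rpow_add ht.1,
    Nat.cast_sub (by omega)]
  simp

/-- The pointwise second order estimate for the Riesz kernel away from the origin. -/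
lemma exists_abs_norm_rpow_taylor_le (n : ℕ) (hn : 2 ≤ n) (cn : ℝ) :
    ∃ C : ℝ, 0 ≤ C ∧ ∀ x h : EuclideanSpace ℝ (Fin n), 2 < ‖x‖ → ‖h‖ < 1 →
      |cn * ‖x + h‖ ^ ((1:ℝ) - n) - cn * ‖x‖ ^ ((1:ℝ) - n) +
        ((n:ℝ) - 1) * cn * ⟪h, x⟫ / ‖x‖ ^ ((n:ℝ) + 1)| ≤ C * ‖x‖ ^ (-(n:ℝ) - 1) := by
  have hn' : (2 : ℝ) ≤ n := by exact_mod_cast hn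
  obtain ⟨p, hp⟩ : ∃ p : ℝ, p = ((1 : ℝ) - n) / 2 := ⟨_, rfl⟩
  obtain ⟨K, hK0, hK⟩ := exists_abs_rpow_sub_one_sub_mul_le (p := p) (by linarith)
  refine ⟨|cn| * (K * 9 + |p|), by positivity, fun x h hx hh ↦ ?_⟩
  have hx0 : 0 < ‖x‖ := by linarith
  have hlow : ‖x‖ / 2 ≤ ‖x + h‖ := by
    have := norm_sub_le (x + h) h
    rw [add_sub_cancel_right] at this
    linarith
  have hs : ‖x + h‖ ^ 2 = ‖x‖ ^ 2 + 2 * ⟪h, x⟫ + ‖h‖ ^ 2 := by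
    rw [norm_add_sq_real, real_inner_comm]
  obtain ⟨u, hu⟩ : ∃ u : ℝ, u = (‖x + h‖ / ‖x‖) ^ 2 := ⟨_, rfl⟩
  have hu4 : 1 / 4 ≤ u := by
    have : 1 / 2 ≤ ‖x + h‖ / ‖x‖ := by rw [le_div_iff₀ hx0]; linarith
    rw [hu]; nlinarith
  have hup : u ^ p = ‖x + h‖ ^ ((1:ℝ) - n) / ‖x‖ ^ ((1:ℝ) - n) := by
    rw [hu, ← Real.rpow_natCast, ← Real.rpow_mul (by positivity),
      ← Real.div_rpow (by positivity) (by positivity), hp]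
    congr 1
    push_cast; ring
  have hu1 : u - 1 = (2 * ⟪h, x⟫ + ‖h‖ ^ 2) / ‖x‖ ^ 2 := by
    rw [hu, div_pow, hs]; field_simp; ring
  have hin : |⟪h, x⟫| ≤ ‖x‖ :=
    (abs_real_inner_le_norm h x).trans (by nlinarith)
  have hh2 : ‖h‖ ^ 2 ≤ 1 := by nlinarith [norm_nonneg h]
  have hu2 : (u - 1) ^ 2 ≤ 9 / ‖x‖ ^ 2 := by
    have : |2 * ⟪h, x⟫ + ‖h‖ ^ 2| ≤ 3 * ‖x‖ := by
      rw [abs_le] at hin ⊢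
      constructor <;> nlinarith [sq_nonneg ‖h‖]
    have := sq_le_sq' (abs_le.1 this).1 (abs_le.1 this).2
    rw [hu1, div_pow, div_le_div_iff₀ (by positivity) (by positivity)]
    nlinarith [sq_nonneg ‖x‖]
  have hA : ‖x‖ ^ ((1:ℝ) - n) = ‖x‖ ^ 2 * ‖x‖ ^ (-(n:ℝ) - 1) := by
    rw [← Real.rpow_natCast, ← Real.rpow_add hx0]
    congr 1; push_cast; ring
  have hB : ‖x‖ ^ ((n:ℝ) + 1) = (‖x‖ ^ (-(n:ℝ) - 1))⁻¹ := by
    rw [← Real.rpow_neg hx0.le]; congr 1; ring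
  have hQ : 0 < ‖x‖ ^ (-(n:ℝ) - 1) := by positivity
  have hE : ‖x + h‖ ^ ((1:ℝ) - n) = u ^ p * ‖x‖ ^ ((1:ℝ) - n) := by
    rw [hup]; field_simp
  have hinner : ⟪h, x⟫ = ((u - 1) * ‖x‖ ^ 2 - ‖h‖ ^ 2) / 2 := by
    rw [hu1]; field_simp; ring
  have key : cn * ‖x + h‖ ^ ((1:ℝ) - n) - cn * ‖x‖ ^ ((1:ℝ) - n) +
      ((n:ℝ) - 1) * cn * ⟪h, x⟫ / ‖x‖ ^ ((n:ℝ) + 1) =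
      cn * (‖x‖ ^ 2 * (u ^ p - 1 - p * (u - 1)) + p * ‖h‖ ^ 2) * ‖x‖ ^ (-(n:ℝ) - 1) := by
    have hnp : (n : ℝ) - 1 = -2 * p := by rw [hp]; ring
    rw [hE, hA, hB, hinner, div_inv_eq_mul, hnp]
    ring
  rw [key, abs_mul, abs_mul, abs_of_pos hQ]
  gcongr
  refine (abs_add_le _ _).trans (add_le_add ?_ ?_)
  · rw [abs_mul, abs_of_nonneg (sq_nonneg ‖x‖)]
    calc ‖x‖ ^ 2 * |u ^ p - 1 - p * (u - 1)| ≤ ‖x‖ ^ 2 * (K * (9 / ‖x‖ ^ 2)) := by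
          gcongr
          exact (hK u hu4).trans (by gcongr)
      _ = K * 9 := by field_simp
  · rw [abs_mul, abs_of_nonneg (sq_nonneg ‖h‖)]
    exact mul_le_of_le_one_right (abs_nonneg p) hh2

/-- Translates of the Riesz kernel by `x` with `‖x‖ ≤ 2` have uniformly bounded integral over the
unit ball. -/
lemma integrableOn_and_setIntegral_norm_add_rpow_le (n : ℕ) (hn : 2 ≤ n)
    (x : EuclideanSpace ℝ (Fin n)) (hx : ‖x‖ ≤ 2) :
    IntegrableOn (fun h ↦ ‖x + h‖ ^ ((1:ℝ) - n)) (Metric.ball 0 1) ∧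
    ∫ h in Metric.ball (0 : EuclideanSpace ℝ (Fin n)) 1, ‖x + h‖ ^ ((1:ℝ) - n) ≤
      ∫ y in Metric.ball (0 : EuclideanSpace ℝ (Fin n)) 3, ‖y‖ ^ ((1:ℝ) - n) := by
  have hmp := measurePreserving_add_left (volume : Measure (EuclideanSpace ℝ (Fin n))) x
  have hme : MeasurableEmbedding (fun h : EuclideanSpace ℝ (Fin n) ↦ x + h) :=
    measurableEmbedding_addLeft x
  have hI := integrableOn_ball_norm_rpow_one_sub n hn 3
  have hsub : Metric.ball (0 : EuclideanSpace ℝ (Fin n)) 1 ⊆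
      (fun h ↦ x + h) ⁻¹' Metric.ball 0 3 := by
    intro h hh
    simp only [Set.mem_preimage, mem_ball_zero_iff] at hh ⊢
    linarith [norm_add_le x h]
  have hI' := (hmp.integrableOn_comp_preimage hme).2 hI
  refine ⟨hI'.mono_set hsub, ?_⟩
  rw [← hmp.setIntegral_preimage_emb hme (fun y ↦ ‖y‖ ^ ((1:ℝ) - n)) (Metric.ball 0 3)]
  exact setIntegral_mono_set hI' (ae_of_all _ fun h ↦ Real.rpow_nonneg (norm_nonneg _) _)
    hsub.eventuallyLE

/-- With `i₁(x) = c_n |x|^{1−n}` the Riesz potential kernel (`n ≥ 2`), the function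
`L(x) = ∫_{|h|<1} |i₁(x+h) − i₁(x) + (n−1) c_n (h·x)/|x|^{n+1} χ_{|x|>2}(x)| dh`
satisfies `L(x) ≤ C(n) min(|x|^{1−n}, |x|^{−n−1})` for `x ≠ 0`. -/
theorem stmt6 (n : ℕ) (hn : 2 ≤ n) (cn : ℝ) :
    ∃ C : ℝ, 0 < C ∧ ∀ x : EuclideanSpace ℝ (Fin n), x ≠ 0 →
      (∫ h in Metric.ball (0 : EuclideanSpace ℝ (Fin n)) 1,
          |cn * ‖x + h‖ ^ ((1:ℝ) - n) - cn * ‖x‖ ^ ((1:ℝ) - n) +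
            (if 2 < ‖x‖ then ((n:ℝ) - 1) * cn * ⟪h, x⟫ / ‖x‖ ^ ((n:ℝ) + 1) else 0)|)
        ≤ C * min (‖x‖ ^ ((1:ℝ) - n)) (‖x‖ ^ (-(n:ℝ) - 1)) := by
  have hn' : (2 : ℝ) ≤ n := by exact_mod_cast hn
  obtain ⟨C₁, hC₁, hfar⟩ := exists_abs_norm_rpow_taylor_le n hn cn
  set V : ℝ := (volume : Measure (EuclideanSpace ℝ (Fin n))).real (Metric.ball 0 1)
  obtain ⟨I, hI⟩ : ∃ I : ℝ,
      I = ∫ y in Metric.ball (0 : EuclideanSpace ℝ (Fin n)) 3, ‖y‖ ^ ((1:ℝ) - n) := ⟨_, rfl⟩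
  have hI0 : 0 ≤ I := hI ▸ integral_nonneg fun y ↦ by positivity
  have hV0 : 0 ≤ V := measureReal_nonneg
  have hC₂ : 0 ≤ |cn| * (I * 2 ^ ((n:ℝ) - 1) + V) * 4 := by positivity
  refine ⟨C₁ * V + |cn| * (I * 2 ^ ((n:ℝ) - 1) + V) * 4 + 1, by positivity, fun x hx ↦ ?_⟩
  have hx0 : 0 < ‖x‖ := norm_pos_iff.2 hx
  have hA : ‖x‖ ^ ((1:ℝ) - n) = ‖x‖ ^ 2 * ‖x‖ ^ (-(n:ℝ) - 1) := by
    rw [← Real.rpow_natCast, ← Real.rpow_add hx0]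
    congr 1; push_cast; ring
  have hQ : 0 < ‖x‖ ^ (-(n:ℝ) - 1) := by positivity
  have hP : 0 < ‖x‖ ^ ((1:ℝ) - n) := by positivity
  have hm : 0 < min (‖x‖ ^ ((1:ℝ) - n)) (‖x‖ ^ (-(n:ℝ) - 1)) := lt_min hP hQ
  by_cases hx2 : 2 < ‖x‖
  · simp only [if_pos hx2]
    have hmin : min (‖x‖ ^ ((1:ℝ) - n)) (‖x‖ ^ (-(n:ℝ) - 1)) = ‖x‖ ^ (-(n:ℝ) - 1) :=
      min_eq_right (by rw [hA]; exact le_mul_of_one_le_left hQ.le (by nlinarith))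
    have hb := norm_setIntegral_le_of_norm_le_const
      (μ := (volume : Measure (EuclideanSpace ℝ (Fin n)))) (s := Metric.ball 0 1)
      (f := fun h ↦ |cn * ‖x + h‖ ^ ((1:ℝ) - n) - cn * ‖x‖ ^ ((1:ℝ) - n) +
        ((n:ℝ) - 1) * cn * ⟪h, x⟫ / ‖x‖ ^ ((n:ℝ) + 1)|)
      (C := C₁ * ‖x‖ ^ (-(n:ℝ) - 1)) measure_ball_lt_top
      (fun h hh ↦ by
        rw [Real.norm_eq_abs, abs_abs]
        exact hfar x h hx2 (by simpa using hh))
    refine (Real.le_norm_self _).trans (hb.trans ?_)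
    rw [hmin]
    change _ * V ≤ _
    nlinarith
  · simp only [if_neg hx2, add_zero]
    have hx2' : ‖x‖ ≤ 2 := not_lt.1 hx2
    obtain ⟨hint, hle⟩ := integrableOn_and_setIntegral_norm_add_rpow_le n hn x hx2'
    have hconst : IntegrableOn (fun _ : EuclideanSpace ℝ (Fin n) ↦ |cn| * ‖x‖ ^ ((1:ℝ) - n))
        (Metric.ball 0 1) := integrableOn_const measure_ball_lt_top.ne
    have h1 : 1 ≤ 2 ^ ((n:ℝ) - 1) * ‖x‖ ^ ((1:ℝ) - n) := by
      calc (1 : ℝ) = 2 ^ ((n:ℝ) - 1) * 2 ^ ((1:ℝ) - n) := by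
            rw [← Real.rpow_add (by norm_num)]; simp
        _ ≤ _ := by
            gcongr ?_ * ?_
            exact Real.rpow_le_rpow_of_nonpos hx0 hx2' (by linarith)
    have hmin : ‖x‖ ^ ((1:ℝ) - n) ≤
        4 * min (‖x‖ ^ ((1:ℝ) - n)) (‖x‖ ^ (-(n:ℝ) - 1)) := by
      rw [mul_min_of_nonneg _ _ (by norm_num)]
      refine le_min (by linarith) ?_
      rw [hA]
      gcongr
      nlinarith
    calc _ ≤ ∫ h in Metric.ball (0 : EuclideanSpace ℝ (Fin n)) 1,
          (|cn| * ‖x + h‖ ^ ((1:ℝ) - n) + |cn| * ‖x‖ ^ ((1:ℝ) - n)) := by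
          refine integral_mono_of_nonneg (ae_of_all _ fun h ↦ abs_nonneg _)
            ((hint.const_mul |cn|).add hconst) (ae_of_all _ fun h ↦ ?_)
          refine (abs_sub _ _).trans_eq ?_
          rw [abs_mul, abs_mul, abs_of_nonneg (by positivity : 0 ≤ ‖x + h‖ ^ ((1:ℝ) - n)),
            abs_of_pos hP]
      _ = |cn| * (∫ h in Metric.ball (0 : EuclideanSpace ℝ (Fin n)) 1,
          ‖x + h‖ ^ ((1:ℝ) - n)) + V * (|cn| * ‖x‖ ^ ((1:ℝ) - n)) := by
          rw [integral_add (hint.const_mul |cn|) hconst, integral_const_mul, setIntegral_const,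
            smul_eq_mul]
      _ ≤ |cn| * (I * (2 ^ ((n:ℝ) - 1) * ‖x‖ ^ ((1:ℝ) - n))) +
          V * (|cn| * ‖x‖ ^ ((1:ℝ) - n)) := by
          gcongr
          exact (hle.trans_eq hI.symm).trans (le_mul_of_one_le_right hI0 h1)
      _ = |cn| * (I * 2 ^ ((n:ℝ) - 1) + V) * ‖x‖ ^ ((1:ℝ) - n) := by ring
      _ ≤ |cn| * (I * 2 ^ ((n:ℝ) - 1) + V) *
          (4 * min (‖x‖ ^ ((1:ℝ) - n)) (‖x‖ ^ (-(n:ℝ) - 1))) := by gcongr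
      _ ≤ _ := by
          rw [← mul_assoc]
          gcongr
          nlinarith [mul_nonneg hC₁ hV0]
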